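/- Let x and y be nonempty words over an alphabet with |x| ≤ |y| ≤ 2|x|. Then the set of positions at which x occurs in y forms a single arithmetic progression. Moreover, if x occurs in y at three or more positions, then the common difference of this arithmetic progression equals per(x). -/

import Mathlib

/-- `x` occurs in `w` at 0-indexed position `i`
    (position `i+1` in the paper's 1-indexed convention). -/
def OccursAt {α : Type*} (x w : List α) (i : ℕ) : Prop := x <+: w.drop i

/-- `p` is a period of `w`: `w[t] = w[t+p]` whenever both positions exist. -/
def HasPeriod {α : Type*} (w : List α) (p : ℕ) : Prop :=
  ∀ i, i + p < w.length → w[i]? = w[i + p]?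

/-- `per(w)`: the smallest positive period of `w`. -/
noncomputable def minPeriod {α : Type*} (w : List α) : ℕ :=
  sInf {p | 0 < p ∧ HasPeriod w p}

theorem occursAt_iff {α : Type*} {x w : List α} {i : ℕ} :
    OccursAt x w i ↔ ∀ t < x.length, w[i + t]? = x[t]? := by
  unfold OccursAt
  rw [List.prefix_iff_getElem?]
  constructor
  · intro h t ht
    rw [← List.getElem?_drop, h t ht, List.getElem?_eq_getElem ht]
  · intro h t ht
    rw [List.getElem?_drop, h t ht, List.getElem?_eq_getElem ht]

theorem OccursAt.add_length_le {α : Type*} {x w : List α} {i : ℕ} (hx : x ≠ [])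
    (h : OccursAt x w i) : i + x.length ≤ w.length := by
  have h3 := h.length_le
  have h4 := List.length_pos_iff.mpr hx
  rw [List.length_drop] at h3
  omega

/-- The distance between two occurrences of `x` is a period of `x`. -/
theorem OccursAt.hasPeriod_sub {α : Type*} {x w : List α} {i j : ℕ} (hij : i ≤ j)
    (hi : OccursAt x w i) (hj : OccursAt x w j) : HasPeriod x (j - i) := by
  rw [occursAt_iff] at hi hj
  intro t ht
  rw [← hj t (by omega), ← hi _ ht]
  congr 1
  omega

theorem HasPeriod.mul_left {α : Type*} {w : List α} {p : ℕ} (h : HasPeriod w p) (k : ℕ) :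
    HasPeriod w (k * p) := by
  induction k with
  | zero => intro i _; simp
  | succ k ih =>
    intro i hi
    rw [Nat.succ_mul] at hi ⊢
    rw [ih i (by omega), h (i + k * p) (by omega), Nat.add_assoc]

theorem HasPeriod.sub {α : Type*} {w : List α} {p q : ℕ} (hp : HasPeriod w p)
    (hq : HasPeriod w q) (hpq : p ≤ q) (hlen : p + q ≤ w.length) : HasPeriod w (q - p) := by
  intro i hi
  by_cases h : i + q < w.length
  · rw [hq i h, hp (i + (q - p)) (by omega)]
    congr 1
    omega
  · have e1 := hp (i - p) (by omega)
    have e2 := hq (i - p) (by omega)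
    rw [show i - p + p = i by omega] at e1
    rw [show i - p + q = i + (q - p) by omega] at e2
    rw [← e1, e2]

theorem minPeriod_spec {α : Type*} {w : List α} (hw : w ≠ []) :
    0 < minPeriod w ∧ HasPeriod w (minPeriod w) :=
  Nat.sInf_mem (s := {p | 0 < p ∧ HasPeriod w p})
    ⟨w.length, List.length_pos_iff.mpr hw, fun i hi => by omega⟩

theorem HasPeriod.minPeriod_le {α : Type*} {w : List α} {p : ℕ} (hp : HasPeriod w p)
    (h0 : 0 < p) : minPeriod w ≤ p :=
  Nat.sInf_le ⟨h0, hp⟩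

/-- A weak form of the Fine–Wilf periodicity lemma. -/
theorem HasPeriod.minPeriod_dvd {α : Type*} {w : List α} (hw : w ≠ []) {q : ℕ}
    (hq : HasPeriod w q) (hlen : minPeriod w + q ≤ w.length) : minPeriod w ∣ q := by
  induction q using Nat.strong_induction_on with
  | _ q ih =>
    obtain ⟨h0, hp⟩ := minPeriod_spec hw
    rcases Nat.eq_zero_or_pos q with rfl | hq0
    · exact dvd_zero _
    · have hle := hq.minPeriod_le hq0
      have h := ih (q - minPeriod w) (by omega) (hp.sub hq hle hlen) (by omega)
      exact (Nat.dvd_sub_iff_left hle dvd_rfl).mp h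

/-- If two occurrences of `x` overlap or touch, and their distance is a multiple of a period `p`,
then `x` also occurs at every intermediate position reached by steps of `p`. -/
theorem OccursAt.add_mul {α : Type*} {x w : List α} {a p k t : ℕ} (hp : HasPeriod x p)
    (ha : OccursAt x w a) (hb : OccursAt x w (a + k * p)) (hk : k * p ≤ x.length)
    (ht : t ≤ k) : OccursAt x w (a + t * p) := by
  obtain ⟨s, rfl⟩ := Nat.exists_eq_add_of_le ht
  rw [Nat.add_mul] at hb hk
  rw [occursAt_iff] at ha hb ⊢
  intro i hi
  by_cases h : t * p + i < x.length
  · rw [Nat.add_assoc, ha _ h, hp.mul_left t i (by omega), Nat.add_comm]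
  · have e := hp.mul_left s (i - s * p) (by omega)
    rw [show i - s * p + s * p = i by omega] at e
    rw [← e, ← hb _ (by omega)]
    congr 1
    omega

/-- for nonempty words `x`, `y` with `|x| ≤ |y| ≤ 2|x|`, the set of
positions at which `x` occurs in `y` is a single arithmetic progression, and if
there are at least 3 occurrences the common difference equals `per(x)`. -/
theorem occurrences_form_arith_progression {α : Type*} (x y : List α)
    (hx : x ≠ []) (hy : y ≠ [])
    (h1 : x.length ≤ y.length) (h2 : y.length ≤ 2 * x.length) :
    ∃ a d m : ℕ,
      {i | OccursAt x y i} = (fun t => a + t * d) '' Set.Iio m ∧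
      (3 ≤ {i | OccursAt x y i}.ncard → d = minPeriod x) := by
  set S := {i | OccursAt x y i}
  have hbd : ∀ i ∈ S, i ≤ x.length := fun i hi => by
    have := OccursAt.add_length_le hx hi
    omega
  have hfin : S.Finite := (Set.finite_Iic x.length).subset hbd
  by_cases hcard : 3 ≤ S.ncard
  · have hne : S.Nonempty := Set.nonempty_of_ncard_ne_zero (by omega)
    obtain ⟨a, haS, ha⟩ := Set.exists_min_image S id hfin hne
    obtain ⟨b, hbS, hb⟩ := Set.exists_max_image S id hfin hne
    simp only [id] at ha hb
    obtain ⟨h0, hp⟩ := minPeriod_spec hx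
    have hbl := hbd b hbS
    have hdvd : ∀ c ∈ S, a < c → c < b → minPeriod x ∣ c - a ∧ minPeriod x ∣ b - c := by
      intro c hc hac hcb
      have p1 := OccursAt.hasPeriod_sub hac.le haS hc
      have p2 := OccursAt.hasPeriod_sub hcb.le hc hbS
      have l1 := p1.minPeriod_le (by omega)
      have l2 := p2.minPeriod_le (by omega)
      exact ⟨p1.minPeriod_dvd hx (by omega), p2.minPeriod_dvd hx (by omega)⟩
    obtain ⟨c, hcS, hc⟩ : ∃ c ∈ S, c ∉ ({a, b} : Set ℕ) :=
      Set.exists_mem_notMem_of_ncard_lt_ncard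
        ((Set.ncard_insert_le a {b}).trans_lt (by rw [Set.ncard_singleton]; omega))
    simp only [Set.mem_insert_iff, Set.mem_singleton_iff, not_or] at hc
    have hac := ha c hcS
    have hcb := hb c hcS
    have hab : minPeriod x ∣ b - a := by
      obtain ⟨d1, d2⟩ := hdvd c hcS (by omega) (by omega)
      rw [show b - a = (c - a) + (b - c) by omega]
      exact dvd_add d1 d2
    obtain ⟨k, hk⟩ := hab
    rw [Nat.mul_comm] at hk
    obtain rfl : b = a + k * minPeriod x := by omega
    refine ⟨a, minPeriod x, k + 1, ?_, fun _ => rfl⟩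
    ext i
    simp only [Set.mem_image, Set.mem_Iio]
    constructor
    · intro hi
      have hai := ha i hi
      have hib := hb i hi
      have hd : minPeriod x ∣ i - a := by
        rcases hai.eq_or_lt with rfl | hai'
        · simp
        rcases hib.eq_or_lt with rfl | hib'
        · simp
        exact (hdvd i hi hai' hib').1
      obtain ⟨t, ht⟩ := hd
      rw [Nat.mul_comm] at ht
      refine ⟨t, ?_, by omega⟩
      have : t * minPeriod x ≤ k * minPeriod x := by omega
      have := Nat.le_of_mul_le_mul_right this h0
      omega
    · rintro ⟨t, ht, rfl⟩
      exact OccursAt.add_mul hp haS hbS (by omega) (by omega)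
  · have h3 : S.ncard = 0 ∨ S.ncard = 1 ∨ S.ncard = 2 := by omega
    rcases h3 with h | h | h
    · rw [Set.ncard_eq_zero hfin] at h
      exact ⟨0, 0, 0, by simp [h], fun h' => absurd h' hcard⟩
    · obtain ⟨a, h⟩ := Set.ncard_eq_one.mp h
      exact ⟨a, 0, 1, by ext i; simp [h, eq_comm], fun h' => absurd h' hcard⟩
    · obtain ⟨a, b, hab, h⟩ := Set.ncard_eq_two.mp h
      wlog hlt : a < b generalizing a b
      · exact this b a hab.symm (by rw [h, Set.pair_comm]) (by omega)
      refine ⟨a, b - a, 2, ?_, fun h' => absurd h' hcard⟩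
      ext i
      simp only [h, Set.mem_insert_iff, Set.mem_singleton_iff, Set.mem_image, Set.mem_Iio]
      constructor
      · rintro (rfl | rfl)
        · exact ⟨0, by omega, by omega⟩
        · exact ⟨1, by omega, by omega⟩
      · rintro ⟨t, ht, rfl⟩
        interval_cases t <;> omega
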